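/- arXiv:2107.14555 — 2 statements merged into one kernel-verified Lean document; each statement's English description precedes it below -/
import Mathlib

section
/- There exists a function f₁ : ℝ → ℝ with the following properties: (1) f₁ is infinitely differentiable; (2) f₁ is non-negative and even; (3) f₁(x) > 0 if and only if x ∈ (−1, 1) (so the support of f₁ is exactly (−1,1)); (4) for every ξ ∈ ℝ, ∫_ℝ f₁(x) cos(ξ x) dx ≥ 0; (5) for every t ∈ ℝ, ∫_ℝ f₁(x) e^{t x} dx ≥ 0; (6) f₁ is non-increasing on [0, 1), i.e. for all 0 ≤ x ≤ y < 1 one has f₁(y) ≤ f₁(x). -/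
open MeasureTheory Real Set

namespace TestFun

/-- The basic even bump supported on `(-1/2, 1/2)`. -/
noncomputable def g (x : ℝ) : ℝ := expNegInvGlue (1 / 4 - x ^ 2)

lemma g_contDiff : ContDiff ℝ (⊤ : ℕ∞) g := by
  have : ContDiff ℝ (⊤ : ℕ∞) (fun x : ℝ => 1 / 4 - x ^ 2) := by fun_prop
  exact expNegInvGlue.contDiff.comp this

lemma g_cont : Continuous g := g_contDiff.continuous

lemma g_nonneg (x : ℝ) : 0 ≤ g x := expNegInvGlue.nonneg _

lemma g_even (x : ℝ) : g (-x) = g x := by simp [g]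

lemma g_mono {u v : ℝ} (h : |u| ≤ |v|) : g v ≤ g u := by
  apply expNegInvGlue.monotone
  have := sq_le_sq.2 h
  linarith

lemma g_zero {x : ℝ} (h : 1 / 2 ≤ |x|) : g x = 0 := by
  apply expNegInvGlue.zero_of_nonpos
  have : |(1 / 2 : ℝ)| ≤ |x| := by rwa [abs_of_pos (by norm_num)]
  have := sq_le_sq.2 this
  linarith

lemma g_pos {x : ℝ} (h : |x| < 1 / 2) : 0 < g x := by
  apply expNegInvGlue.pos_of_pos
  have : |x| < |(1 / 2 : ℝ)| := by rwa [abs_of_pos (a := (1 / 2 : ℝ)) (by norm_num)]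
  have := sq_lt_sq.2 this
  linarith

lemma g_supp : HasCompactSupport g := by
  apply HasCompactSupport.intro (isCompact_Icc (a := (-1 : ℝ)) (b := 1))
  intro x hx
  apply g_zero
  by_contra! h
  have := abs_lt.1 h
  exact hx ⟨by linarith, by linarith⟩

/-- Convolution square of `g`. -/
noncomputable def f : ℝ → ℝ := convolution g g (ContinuousLinearMap.mul ℝ ℝ) volume

lemma f_apply (x : ℝ) : f x = ∫ t, g t * g (x - t) := rfl

lemma f_contDiff : ContDiff ℝ (⊤ : ℕ∞) f :=
  g_supp.contDiff_convolution_right _ g_cont.locallyIntegrable g_contDiff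

lemma f_nonneg (x : ℝ) : 0 ≤ f x :=
  integral_nonneg fun _ => mul_nonneg (g_nonneg _) (g_nonneg _)

lemma f_even (x : ℝ) : f (-x) = f x := by
  rw [f_apply, f_apply, ← integral_neg_eq_self]
  congr 1
  ext t
  rw [g_even, ← g_even (x - t)]
  congr 2
  ring

lemma int_g_mul {h : ℝ → ℝ} (hh : Continuous h) : Integrable (fun t => g t * h t) :=
  (g_cont.mul hh).integrable_of_hasCompactSupport g_supp.mul_right

lemma f_pos {x : ℝ} (hx : |x| < 1) : 0 < f x := by
  rw [f_apply]
  have hc : Continuous (fun t => g t * g (x - t)) :=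
    g_cont.mul (g_cont.comp (by fun_prop))
  have hx2 : |x / 2| < 1 / 2 := by
    rw [abs_div, abs_two]; linarith
  refine hc.integral_pos_of_hasCompactSupport_nonneg_nonzero (x := x / 2) g_supp.mul_right
    (fun _ => mul_nonneg (g_nonneg _) (g_nonneg _)) ?_
  have : x - x / 2 = x / 2 := by ring
  rw [this]
  exact (mul_pos (g_pos hx2) (g_pos hx2)).ne'

lemma f_zero {x : ℝ} (hx : 1 ≤ |x|) : f x = 0 := by
  rw [f_apply]
  have : (fun t => g t * g (x - t)) = fun _ => 0 := by
    ext t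
    by_cases ht : 1 / 2 ≤ |t|
    · rw [g_zero ht, zero_mul]
    · rw [g_zero (x := x - t), mul_zero]
      have := abs_sub_abs_le_abs_sub x t
      linarith
  rw [this, integral_zero]

lemma f_anti {x y : ℝ} (hx : 0 ≤ x) (hxy : x ≤ y) : f y ≤ f x := by
  have i1 : Integrable (fun t => g t * g (x - t)) := int_g_mul (g_cont.comp (by fun_prop))
  have i2 : Integrable (fun t => g t * g (y - t)) := int_g_mul (g_cont.comp (by fun_prop))
  set F : ℝ → ℝ := fun t => g t * g (x - t) - g t * g (y - t) with hF
  have iF : Integrable F := i1.sub i2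
  have e1 : f x - f y = ∫ t, F t := by
    rw [f_apply, f_apply, ← integral_sub i1 i2]
  have e2 : ∫ t, F (x + y - t) = ∫ t, F t := integral_sub_left_eq_self F volume (x + y)
  have e3 : 2 * (f x - f y) = ∫ t, (F t + F (x + y - t)) := by
    rw [integral_add iF (iF.comp_sub_left (x + y)), e2, e1]; ring
  have : 0 ≤ ∫ t, (F t + F (x + y - t)) := by
    apply integral_nonneg
    intro t
    have k1 : g (x - (x + y - t)) = g (y - t) := by
      rw [← g_even (y - t)]; congr 1; ring
    have k2 : g (y - (x + y - t)) = g (x - t) := by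
      rw [← g_even (x - t)]; congr 1; ring
    have k : F t + F (x + y - t) = (g t - g (x + y - t)) * (g (x - t) - g (y - t)) := by
      simp only [hF, k1, k2]; ring
    change 0 ≤ F t + F (x + y - t)
    rw [k]
    rcases le_total (2 * t) (x + y) with h | h
    · apply mul_nonneg
      · exact sub_nonneg.2 (g_mono (sq_le_sq.1 (by nlinarith)))
      · exact sub_nonneg.2 (g_mono (sq_le_sq.1 (by nlinarith)))
    · apply mul_nonneg_of_nonpos_of_nonpos
      · exact sub_nonpos.2 (g_mono (sq_le_sq.1 (by nlinarith)))
      · exact sub_nonpos.2 (g_mono (sq_le_sq.1 (by nlinarith)))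
  linarith

lemma int_sin (ξ : ℝ) : ∫ t, g t * Real.sin (ξ * t) = 0 := by
  have h := integral_neg_eq_self (fun t => g t * Real.sin (ξ * t)) volume
  simp only [g_even, mul_neg, Real.sin_neg, integral_neg] at h
  linarith

lemma f_cos (ξ : ℝ) : 0 ≤ ∫ x, f x * Real.cos (ξ * x) := by
  have ic : Integrable (fun t => g t * Real.cos (ξ * t)) := int_g_mul (by fun_prop)
  have is : Integrable (fun t => g t * Real.sin (ξ * t)) := int_g_mul (by fun_prop)
  have hc := integral_convolution (μ := volume) (ν := volume) (ContinuousLinearMap.mul ℝ ℝ) ic ic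
  have hs := integral_convolution (μ := volume) (ν := volume) (ContinuousLinearMap.mul ℝ ℝ) is is
  have jc := ic.integrable_convolution (ContinuousLinearMap.mul ℝ ℝ) ic
  have js := is.integrable_convolution (ContinuousLinearMap.mul ℝ ℝ) is
  have key : ∀ x, f x * Real.cos (ξ * x) =
      convolution (fun t => g t * Real.cos (ξ * t)) (fun t => g t * Real.cos (ξ * t))
        (ContinuousLinearMap.mul ℝ ℝ) volume x -
      convolution (fun t => g t * Real.sin (ξ * t)) (fun t => g t * Real.sin (ξ * t))
        (ContinuousLinearMap.mul ℝ ℝ) volume x := by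
    intro x
    simp only [convolution, ContinuousLinearMap.mul_apply']
    rw [← integral_sub, f_apply, ← integral_mul_const]
    · congr 1
      ext t
      have : ξ * x = ξ * t + ξ * (x - t) := by ring
      rw [this, Real.cos_add]
      ring
    · simp only [mul_assoc]
      have := g_cont
      exact int_g_mul (by fun_prop)
    · simp only [mul_assoc]
      have := g_cont
      exact int_g_mul (by fun_prop)
  simp only [key]
  rw [integral_sub jc js, hc, hs, int_sin]
  simp only [ContinuousLinearMap.mul_apply', mul_zero, sub_zero]
  exact mul_self_nonneg _

end TestFun

/-- There exists a smooth, non-negative, even function `f₁ : ℝ → ℝ` whose support is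
exactly `(-1, 1)`, whose Fourier transform is non-negative on `ℝ ∪ iℝ`
(expressed via the cosine and exponential integrals), and which is non-increasing
on `[0, 1)`. -/
theorem exists_test_function :
    ∃ f₁ : ℝ → ℝ,
      ContDiff ℝ (⊤ : ℕ∞) f₁ ∧
      (∀ x, 0 ≤ f₁ x) ∧
      (∀ x, f₁ (-x) = f₁ x) ∧
      (∀ x, 0 < f₁ x ↔ x ∈ Set.Ioo (-1 : ℝ) 1) ∧
      (∀ ξ : ℝ, 0 ≤ ∫ x : ℝ, f₁ x * Real.cos (ξ * x)) ∧
      (∀ t : ℝ, 0 ≤ ∫ x : ℝ, f₁ x * Real.exp (t * x)) ∧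
      (∀ x y : ℝ, 0 ≤ x → x ≤ y → y < 1 → f₁ y ≤ f₁ x) := by
  refine ⟨TestFun.f, TestFun.f_contDiff, TestFun.f_nonneg, TestFun.f_even, ?_, TestFun.f_cos,
    fun t => integral_nonneg fun x => mul_nonneg (TestFun.f_nonneg x) (Real.exp_pos _).le,
    fun x y hx hxy _ => TestFun.f_anti hx hxy⟩
  intro x
  rw [Set.mem_Ioo, ← abs_lt]
  refine ⟨fun h => ?_, TestFun.f_pos⟩
  by_contra! h1
  exact h.ne' (TestFun.f_zero h1)
end

section
/- Let f : ℝ → ℝ be infinitely differentiable, even, and compactly supported. Then −(1/(√2 · π)) · ∫_0^∞ f′(u) / √(cosh u − 1) du = (1/(4π)) · ∫_{−∞}^{∞} r · tanh(π r) · ( ∫_ℝ f(x) cos(r x) dx ) dr. -/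
open MeasureTheory Real Set

lemma aux_deriv (r : ℝ) : HasDerivAt (fun r : ℝ => Real.sigmoid (2 * π * r))
    (2 * π * (Real.sigmoid (2 * π * r) * (1 - Real.sigmoid (2 * π * r)))) r := by
  have h1 : HasDerivAt (fun r : ℝ => 2 * π * r) (2 * π) r := by
    simpa using (hasDerivAt_id r).const_mul (2 * π)
  have := (Real.hasDerivAt_sigmoid (2 * π * r)).comp r h1
  convert! this using 1
  ring

lemma aux_inj : Function.Injective (fun r : ℝ => Real.sigmoid (2 * π * r)) := by
  intro a b h
  have := Real.sigmoid_injective h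
  exact mul_left_cancel₀ (by positivity) this

lemma aux_image : (fun r : ℝ => Real.sigmoid (2 * π * r)) '' univ = Ioo 0 1 := by
  rw [← Real.range_sigmoid, image_univ]
  have : (fun r : ℝ => Real.sigmoid (2 * π * r)) = Real.sigmoid ∘ (fun r => 2 * π * r) := rfl
  rw [this, Set.range_comp, Function.Surjective.range_eq, image_univ]
  intro y
  exact ⟨y / (2 * π), by field_simp⟩

lemma aux_pos (r : ℝ) :
    0 ≤ 2 * π * (Real.sigmoid (2 * π * r) * (1 - Real.sigmoid (2 * π * r))) := by
  have := Real.sigmoid_nonneg (2 * π * r)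
  have := Real.sigmoid_le_one (2 * π * r)
  have : 0 ≤ 1 - Real.sigmoid (2 * π * r) := by linarith
  positivity

lemma aux_integrable : Integrable
    (fun r : ℝ => 2 * π * (Real.sigmoid (2 * π * r) * (1 - Real.sigmoid (2 * π * r)))) := by
  have h := integrableOn_image_iff_integrableOn_abs_deriv_smul (s := univ) MeasurableSet.univ
    (fun x _ => (aux_deriv x).hasDerivWithinAt) aux_inj.injOn (fun _ => (1 : ℝ))
  rw [aux_image] at h
  have h2 := h.1 (by simp)
  rw [integrableOn_univ] at h2
  simpa [abs_of_nonneg (aux_pos _)] using! h2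

lemma aux_cpow (y : ℝ) (a : ℂ) :
    (Real.sigmoid y : ℂ) ^ a * (1 - (Real.sigmoid y : ℂ)) ^ (-a) = Complex.exp (a * y) := by
  have h0 := Real.sigmoid_pos y
  have h1 : 0 < 1 - Real.sigmoid y := by linarith [Real.sigmoid_lt_one y]
  have e : (1 - (Real.sigmoid y : ℂ)) = ((1 - Real.sigmoid y : ℝ) : ℂ) := by push_cast; rfl
  rw [e, Complex.cpow_def_of_ne_zero (by exact_mod_cast h0.ne'),
    Complex.cpow_def_of_ne_zero (by exact_mod_cast h1.ne'), ← Complex.exp_add,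
    ← Complex.ofReal_log h0.le, ← Complex.ofReal_log h1.le]
  have : Real.log (1 - Real.sigmoid y) = Real.log (Real.sigmoid y) - y := by
    rw [← Real.sigmoid_neg, ← Real.sigmoid_mul_rexp_neg, Real.log_mul h0.ne' (Real.exp_ne_zero _),
      Real.log_exp]
    ring
  rw [this]
  congr 1
  push_cast
  ring

lemma aux_beta (a : ℂ) (h1 : a.re = 0) (h0 : a ≠ 0) :
    Complex.betaIntegral (1 + a) (1 - a) = π * a / Complex.sin (π * a) := by
  have h := Complex.Gamma_mul_Gamma_eq_betaIntegral (s := 1 + a) (t := 1 - a)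
    (by simp [h1]) (by simp [h1])
  have e : (1 + a) + (1 - a) = ((1 : ℕ) : ℂ) + 1 := by push_cast; ring
  rw [e, Complex.Gamma_nat_eq_factorial, add_comm 1 a, Complex.Gamma_add_one a h0, mul_assoc,
    Complex.Gamma_mul_Gamma_one_sub] at h
  simp at h
  rw [add_comm 1 a, ← h]
  ring

lemma aux_fourier (x : ℝ) (hx : x ≠ 0) :
    ∫ r : ℝ, 2 * π * (Real.sigmoid (2 * π * r) * (1 - Real.sigmoid (2 * π * r))) * cos (r * x)
      = x / 2 / sinh (x / 2) := by
  set a : ℂ := Complex.I * x / (2 * π) with ha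
  have hpi : (π : ℂ) ≠ 0 := by exact_mod_cast pi_ne_zero
  have ha0 : a ≠ 0 := by simp [ha, hx, hpi]
  have ha1 : a.re = 0 := by
    have : a = Complex.I * ((x / (2 * π) : ℝ) : ℂ) := by rw [ha]; push_cast; ring
    rw [this, Complex.I_mul_re, Complex.ofReal_im, neg_zero]
  have hb := aux_beta a ha1 ha0
  rw [Complex.betaIntegral, intervalIntegral.integral_of_le zero_le_one, integral_Ioc_eq_integral_Ioo,
    ← aux_image, integral_image_eq_integral_abs_deriv_smul (s := univ) MeasurableSet.univ
    (fun x _ => (aux_deriv x).hasDerivWithinAt) aux_inj.injOn, setIntegral_univ] at hb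
  have e1 : (1 + a - 1) = a := by ring
  have e2 : (1 - a - 1) = -a := by ring
  simp_rw [e1, e2, aux_cpow, abs_of_nonneg (aux_pos _)] at hb
  have hs : (π * a / Complex.sin (π * a)) = ((x / 2 / sinh (x / 2) : ℝ) : ℂ) := by
    have : π * a = ((x / 2 : ℝ) : ℂ) * Complex.I := by
      rw [ha]; push_cast; field_simp
    rw [this, Complex.sin_mul_I]
    rw [Complex.ofReal_div (x/2), Complex.ofReal_sinh]
    rw [mul_div_mul_right _ _ Complex.I_ne_zero]
  rw [hs] at hb
  have hb2 := congrArg Complex.re hb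
  rw [Complex.ofReal_re] at hb2
  rw [← hb2]
  have hexp : ∀ r : ℝ, Complex.exp (a * ((2 * π * r : ℝ) : ℂ)) = Complex.exp (((r * x : ℝ) : ℂ) * Complex.I) := by
    intro r
    congr 1
    rw [ha]; push_cast; field_simp
  simp_rw [hexp]
  have hint : Integrable (fun r : ℝ => (2 * π * (Real.sigmoid (2 * π * r) * (1 - Real.sigmoid (2 * π * r)))) •
      Complex.exp (((r * x : ℝ) : ℂ) * Complex.I)) := by
    refine aux_integrable.smul_bdd 1 ?_ ?_
    · exact Continuous.aestronglyMeasurable (by fun_prop)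
    · exact Filter.Eventually.of_forall fun r => by rw [Complex.norm_exp_ofReal_mul_I]
  have := integral_re hint
  simp only [RCLike.re_eq_complex_re] at this
  rw [← this]
  congr 1
  ext r
  rw [Complex.smul_re, Complex.exp_ofReal_mul_I_re, smul_eq_mul]

lemma osc_int {h : ℝ → ℝ} (hc : Continuous h) (hs : HasCompactSupport h) {k : ℝ → ℝ}
    (hk : Continuous k) : Integrable (fun x => h x * k x) :=
  (hc.mul hk).integrable_of_hasCompactSupport hs.mul_right

lemma ibp_cos {h : ℝ → ℝ} (hd : ContDiff ℝ 1 h) (hs : HasCompactSupport h) (r : ℝ) :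
    r * ∫ x, h x * cos (r * x) = - ∫ x, deriv h x * sin (r * x) := by
  have hsin : ∀ x : ℝ, HasDerivAt (fun x => sin (r * x)) (cos (r * x) * r) x := fun x => by
    simpa using ((hasDerivAt_id x).const_mul r).sin
  have := integral_mul_deriv_eq_deriv_mul_of_integrable (u := h) (u' := deriv h)
    (v := fun x => sin (r * x)) (v' := fun x => cos (r * x) * r)
    (fun x _ => (hd.differentiable one_ne_zero x).hasDerivAt) (fun x _ => hsin x)
    (osc_int hd.continuous hs (by fun_prop))
    (osc_int (hd.continuous_deriv le_rfl) hs.deriv (by fun_prop))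
    (osc_int hd.continuous hs (by fun_prop))
  rw [← this, ← integral_const_mul]
  congr 1; ext x; ring

lemma ibp_sin {h : ℝ → ℝ} (hd : ContDiff ℝ 1 h) (hs : HasCompactSupport h) (r : ℝ) :
    r * ∫ x, h x * sin (r * x) = ∫ x, deriv h x * cos (r * x) := by
  have hsin : ∀ x : ℝ, HasDerivAt (fun x => cos (r * x)) (-sin (r * x) * r) x := fun x => by
    simpa using ((hasDerivAt_id x).const_mul r).cos
  have := integral_mul_deriv_eq_deriv_mul_of_integrable (u := h) (u' := deriv h)
    (v := fun x => cos (r * x)) (v' := fun x => -sin (r * x) * r)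
    (fun x _ => (hd.differentiable one_ne_zero x).hasDerivAt) (fun x _ => hsin x)
    (osc_int hd.continuous hs (by fun_prop))
    (osc_int (hd.continuous_deriv le_rfl) hs.deriv (by fun_prop))
    (osc_int hd.continuous hs (by fun_prop))
  rw [← neg_inj, ← this, ← integral_const_mul, ← integral_neg]
  congr 1; ext x; ring

lemma osc_bound {h : ℝ → ℝ} (hc : Continuous h) (hs : HasCompactSupport h) (r : ℝ) :
    |∫ x, h x * sin (r * x)| ≤ ∫ x, |h x| := by
  rw [← Real.norm_eq_abs]
  refine (norm_integral_le_integral_norm (μ := volume) (fun x => h x * sin (r * x))).trans ?_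
  refine integral_mono (osc_int hc hs (by fun_prop)).norm
    (hc.integrable_of_hasCompactSupport hs).abs fun x => ?_
  simp only [norm_mul, Real.norm_eq_abs]
  exact mul_le_of_le_one_right (abs_nonneg _) (abs_sin_le_one _)

lemma osc_sin_integrable {h : ℝ → ℝ} (hd : ContDiff ℝ 2 h) (hs : HasCompactSupport h) :
    Integrable (fun r : ℝ => ∫ x, h x * sin (r * x)) := by
  have hd1 : ContDiff ℝ 1 h := hd.of_le (by norm_num)
  have hd' : ContDiff ℝ 1 (deriv h) := by
    have : ContDiff ℝ (1 + 1) h := by convert hd using 1; norm_num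
    exact (contDiff_succ_iff_deriv.1 this).2.2
  have hcont : Continuous (fun r : ℝ => ∫ x, h x * sin (r * x)) := by
    refine continuous_of_dominated (bound := fun x => |h x|) ?_ ?_ ?_ ?_
    · exact fun r => (osc_int hd.continuous hs (by fun_prop)).aestronglyMeasurable
    · refine fun r => Filter.Eventually.of_forall fun x => ?_
      simp only [norm_mul, Real.norm_eq_abs]
      exact mul_le_of_le_one_right (abs_nonneg _) (abs_sin_le_one _)
    · exact (hd.continuous.integrable_of_hasCompactSupport hs).abs
    · exact Filter.Eventually.of_forall fun x => by fun_prop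
  set C := (∫ x, |h x|) + ∫ x, |deriv (deriv h) x| with hC
  refine (integrable_inv_one_add_sq.const_mul C).mono' hcont.aestronglyMeasurable
    (Filter.Eventually.of_forall fun r => ?_)
  have b1 := osc_bound hd.continuous hs r
  have b2 := osc_bound (hd'.continuous_deriv le_rfl) hs.deriv.deriv r
  have e : r ^ 2 * ∫ x, h x * sin (r * x) = - ∫ x, deriv (deriv h) x * sin (r * x) := by
    rw [sq, mul_assoc, ibp_sin hd1 hs, ibp_cos hd' hs.deriv]
  rw [← abs_neg, ← e, abs_mul, abs_of_nonneg (sq_nonneg r)] at b2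
  rw [Real.norm_eq_abs, ← div_eq_mul_inv, le_div_iff₀ (by positivity)]
  linarith

lemma riemann_lebesgue_cos {p : ℝ → ℝ} (hp : Integrable p) :
    Filter.Tendsto (fun r : ℝ => ∫ x, p x * cos (r * x)) (Filter.cocompact ℝ) (nhds 0) := by
  have h := Real.tendsto_integral_exp_smul_cocompact (fun x => (p x : ℂ))
  have hm : Filter.Tendsto (fun r : ℝ => (2 * π)⁻¹ * r) (Filter.cocompact ℝ) (Filter.cocompact ℝ) :=
    (Homeomorph.mulLeft₀ ((2 * π)⁻¹) (by positivity)).isClosedEmbedding.tendsto_cocompact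
  have h2 := (Complex.continuous_re.tendsto 0).comp (h.comp hm)
  rw [Complex.zero_re] at h2
  refine h2.congr fun r => ?_
  have hint : Integrable (fun v : ℝ => Real.fourierChar (-(v * ((2 * π)⁻¹ * r))) • (p v : ℂ)) := by
    have := (Real.fourierIntegral_convergent_iff (μ := volume) (f := fun v : ℝ => (p v : ℂ)) ((2 * π)⁻¹ * r)).2 hp.ofReal
    simpa [mul_comm] using this
  have := integral_re hint
  simp only [RCLike.re_eq_complex_re] at this
  simp only [Function.comp]
  rw [← this]
  congr 1
  ext x
  rw [Circle.smul_def, Real.fourierChar_apply, smul_eq_mul, Complex.re_mul_ofReal, Complex.exp_ofReal_mul_I_re, mul_comm]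
  congr 1
  rw [← cos_neg]
  congr 1
  field_simp

lemma tanh_sigmoid (r : ℝ) : tanh (π * r) = 2 * Real.sigmoid (2 * π * r) - 1 := by
  rw [Real.tanh_eq_sinh_div_cosh, Real.sinh_eq, Real.cosh_eq, Real.sigmoid_def]
  have e : rexp (-(2 * π * r)) = rexp (-(π * r)) * rexp (-(π * r)) := by rw [← exp_add]; ring_nf
  have e2 : rexp (π * r) = (rexp (-(π * r)))⁻¹ := by rw [exp_neg, inv_inv]
  have := exp_pos (-(π * r))
  rw [e, e2]
  field_simp
  ring

/-- Core identity. -/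
lemma core {p : ℝ → ℝ} (hp : Continuous p) (hs : HasCompactSupport p)
    (hG : Integrable (fun r : ℝ => ∫ x, (x * p x) * sin (r * x))) :
    ∫ r : ℝ, tanh (π * r) * ∫ x, (x * p x) * sin (r * x) = ∫ x, (x * p x) / sinh (x / 2) := by
  have hpi : Integrable p := hp.integrable_of_hasCompactSupport hs
  have hxc : Continuous fun x => x * p x := by fun_prop
  have hxs : HasCompactSupport fun x => x * p x := hs.mul_left
  set w : ℝ → ℝ := fun r => 2 * π * (Real.sigmoid (2 * π * r) * (1 - Real.sigmoid (2 * π * r))) with hw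
  have hu : ∀ r, HasDerivAt (fun r => tanh (π * r)) (2 * w r) r := by
    intro r
    simp_rw [tanh_sigmoid]
    exact ((aux_deriv r).const_mul 2).sub_const 1
  have hv : ∀ r : ℝ, HasDerivAt (fun r => ∫ x, p x * cos (r * x)) (∫ x, -((x * p x) * sin (r * x))) r := by
    intro r
    refine (hasDerivAt_integral_of_dominated_loc_of_deriv_le (μ := volume) (s := univ)
      (F := fun r x => p x * cos (r * x)) (F' := fun r x => -((x * p x) * sin (r * x))) (bound := fun x => |x * p x|)
      Filter.univ_mem ?_ ?_ ?_ ?_ ?_ ?_).2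
    · exact Filter.Eventually.of_forall fun r => (osc_int hp hs (by fun_prop)).aestronglyMeasurable
    · exact osc_int hp hs (by fun_prop)
    · exact (osc_int hxc hxs (by fun_prop)).neg.aestronglyMeasurable
    · refine Filter.Eventually.of_forall fun x s _ => ?_
      rw [norm_neg, norm_mul, Real.norm_eq_abs, Real.norm_eq_abs]
      exact mul_le_of_le_one_right (abs_nonneg _) (abs_sin_le_one _)
    · exact (hxc.integrable_of_hasCompactSupport hxs).abs
    · refine Filter.Eventually.of_forall fun x s _ => ?_
      have := (((hasDerivAt_id s).mul_const x).cos).const_mul (p x)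
      convert! this using 1
      simp; ring
  have htb : ∀ r : ℝ, ‖tanh (π * r)‖ ≤ 1 := fun r => by
    rw [tanh_sigmoid, Real.norm_eq_abs, abs_le]
    constructor <;> linarith [Real.sigmoid_nonneg (2 * π * r), Real.sigmoid_le_one (2 * π * r)]
  have htc : Continuous fun r : ℝ => tanh (π * r) :=
    continuous_iff_continuousAt.2 fun r => (hu r).continuousAt
  have hwi : Integrable w := aux_integrable
  have hprod : Integrable (Function.uncurry fun r x : ℝ => w r * (p x * cos (r * x))) (volume.prod volume) := by
    have h1 := hwi.mul_prod hpi
    have h2 := h1.mul_bdd (g := fun z : ℝ × ℝ => cos (z.1 * z.2)) (c := 1)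
      (Continuous.aestronglyMeasurable (by fun_prop))
      (Filter.Eventually.of_forall fun z => by rw [Real.norm_eq_abs]; exact abs_cos_le_one _)
    refine h2.congr (Filter.Eventually.of_forall fun z => ?_)
    simp [Function.uncurry, mul_assoc]
  have hwP : Integrable fun r => w r * ∫ x, p x * cos (r * x) := by
    have := hprod.integral_prod_left
    simpa [Function.uncurry, integral_const_mul] using this
  have hlim := riemann_lebesgue_cos hpi
  have hzero : Filter.Tendsto (fun r => tanh (π * r) * ∫ x, p x * cos (r * x)) (Filter.cocompact ℝ) (nhds 0) := by
    have hn := hlim.norm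
    rw [norm_zero] at hn
    refine squeeze_zero_norm (fun r => ?_) hn
    rw [norm_mul]
    exact mul_le_of_le_one_left (norm_nonneg _) (htb r)
  have key := integral_mul_deriv_eq_deriv_mul (u := fun r => tanh (π * r)) (u' := fun r => 2 * w r)
    (v := fun r => ∫ x, p x * cos (r * x)) (v' := fun r => ∫ x, -((x * p x) * sin (r * x)))
    (fun r _ => hu r) (fun r _ => hv r)
    (by
      have := hG.neg.bdd_mul (f := fun r => tanh (π * r)) (c := 1) htc.aestronglyMeasurable
        (Filter.Eventually.of_forall htb)
      refine this.congr (Filter.Eventually.of_forall fun r => ?_)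
      simp [integral_neg])
    (by
      refine (hwP.const_mul 2).congr (Filter.Eventually.of_forall fun r => ?_)
      simp [mul_assoc])
    (hzero.mono_left atBot_le_cocompact) (hzero.mono_left atTop_le_cocompact)
  simp only [integral_neg, mul_neg, sub_zero, zero_sub, neg_inj] at key
  rw [key]
  have e1 : ∀ r, 2 * w r * ∫ x, p x * cos (r * x) = 2 * ∫ x, w r * (p x * cos (r * x)) := by
    intro r
    rw [integral_const_mul, mul_assoc]
  simp_rw [e1]
  rw [integral_const_mul, integral_integral_swap hprod, ← integral_const_mul]
  refine integral_congr_ae ?_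
  have : ∀ᵐ x : ℝ, x ≠ 0 := by simp [ae_iff]
  filter_upwards [this] with x hx
  have h := aux_fourier x hx
  have e : ∀ r, w r * (p x * cos (r * x)) = p x * (w r * cos (r * x)) := fun r => by ring
  simp_rw [e]
  rw [integral_const_mul, h]
  ring

theorem inverseAbelTransform_zero_eq_plancherel (f : ℝ → ℝ)
    (hsmooth : ContDiff ℝ (⊤ : ℕ∞) f)
    (heven : ∀ x, f (-x) = f x)
    (hcompact : HasCompactSupport f) :
    -(1 / (Real.sqrt 2 * Real.pi)) *
        (∫ u in Set.Ioi (0 : ℝ), deriv f u / Real.sqrt (Real.cosh u - 1)) =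
      (1 / (4 * Real.pi)) *
        ∫ r : ℝ, r * Real.tanh (Real.pi * r) * ∫ x : ℝ, f x * Real.cos (r * x) := by
  have hf1 : ContDiff ℝ 1 f := hsmooth.of_le (by exact_mod_cast le_top)
  have hg : ContDiff ℝ 2 (deriv f) := by
    have : ContDiff ℝ (2 + 1) f := by
      rw [show (2 + 1 : WithTop ℕ∞) = ((3 : ℕ∞) : WithTop ℕ∞) by norm_num]
      exact hsmooth.of_le (by exact_mod_cast le_top)
    exact (contDiff_succ_iff_deriv.1 this).2.2
  have hodd : ∀ x, deriv f (-x) = - deriv f x := by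
    intro x
    have h1 : (fun y => f (-y)) = f := funext heven
    have := deriv_comp_neg f x
    rw [h1] at this
    linarith
  have hg0 : deriv f 0 = 0 := by have := hodd 0; simp at this; linarith
  set p := dslope (deriv f) 0 with hpdef
  have hxp : ∀ x, x * p x = deriv f x := by
    intro x
    have := sub_smul_dslope (deriv f) 0 x
    simpa [hg0] using this
  have hpc : Continuous p := by
    rw [← continuousOn_univ]
    exact (continuousOn_dslope Filter.univ_mem).2
      ⟨hg.continuous.continuousOn, hg.differentiable (by norm_num) 0⟩
  have hps : HasCompactSupport p := by
    refine HasCompactSupport.intro (K := insert 0 (tsupport (deriv f))) (hcompact.deriv.isCompact.insert 0) ?_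
    intro x hx
    rw [mem_insert_iff, not_or] at hx
    have h1 : deriv f x = 0 := image_eq_zero_of_notMem_tsupport hx.2
    have := hxp x
    rw [h1] at this
    exact (mul_eq_zero.1 this).resolve_left hx.1
  have hc := core hpc hps (by
    simp_rw [hxp]; exact osc_sin_integrable hg hcompact.deriv)
  simp_rw [hxp] at hc
  have hR : (∫ r : ℝ, r * Real.tanh (Real.pi * r) * ∫ x : ℝ, f x * Real.cos (r * x))
      = - ∫ x, deriv f x / sinh (x / 2) := by
    rw [← hc, ← integral_neg]
    congr 1; ext r
    rw [mul_comm r, mul_assoc, ibp_cos hf1 hcompact]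
    ring
  have hL : (∫ u in Set.Ioi (0 : ℝ), deriv f u / Real.sqrt (Real.cosh u - 1))
      = (1 / √2) * ∫ u in Set.Ioi (0 : ℝ), deriv f u / sinh (u / 2) := by
    rw [← integral_const_mul]
    refine setIntegral_congr_fun measurableSet_Ioi fun u hu => ?_
    have hu' : 0 < u := hu
    have hc2 : cosh u - 1 = 2 * sinh (u / 2) ^ 2 := by
      have := Real.cosh_two_mul (u / 2)
      rw [Real.cosh_sq] at this
      rw [show 2 * (u / 2) = u by ring] at this
      linarith
    rw [hc2, Real.sqrt_mul (by norm_num), Real.sqrt_sq (Real.sinh_nonneg_iff.2 (by linarith))]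
    rw [one_div, mul_comm √2, ← div_div, div_eq_inv_mul _ √2]
  have hE : ∫ x, deriv f x / sinh (x / 2) = 2 * ∫ u in Set.Ioi (0 : ℝ), deriv f u / sinh (u / 2) := by
    rw [← integral_comp_abs (f := fun x => deriv f x / sinh (x / 2))]
    congr 1; ext x
    rcases abs_choice x with h | h
    · rw [h]
    · rw [h, hodd, neg_div 2 x, Real.sinh_neg, neg_div_neg_eq]
  rw [hR, hL, hE]
  have h2 : √2 * √2 = 2 := Real.mul_self_sqrt (by norm_num)
  have h3 : √2 ≠ 0 := by positivity
  have hpi := pi_ne_zero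
  field_simp
  rw [sq, h2]; ring
end
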